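/- There exists a constant C > 0 such that for every T ≥ 1, ∫_{sinh²(2T)}^{∞} |k_T(t)| dt ≤ C·e^{−T}. (This is the rapid-decay bound of the paper's Lemma on the hyperbolic kernel: k_T decays rapidly outside a ball of radius 4T.) -/

import Mathlib

open Real MeasureTheory

/-- `Q_T(ω) = 2(4ω+2)cosh(T)/((4ω+2)² − 2 + 2cosh(2T))`. -/
noncomputable def QT (T ω : ℝ) : ℝ :=
  2 * (4 * ω + 2) * Real.cosh T / ((4 * ω + 2) ^ 2 - 2 + 2 * Real.cosh (2 * T))

/-- The radial kernel with spherical transform `cos(rT)/cosh(πr/2)`: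
`k_T(t) = −(1/π) ∫_t^∞ Q_T′(ω) (ω − t)^{−1/2} dω`. -/
noncomputable def kT (T t : ℝ) : ℝ :=
  -(1 / Real.pi) * ∫ ω in Set.Ioi t, deriv (QT T) ω / Real.sqrt (ω - t)

/-- On the positive half-line, `|Q_T′(ω)| ≤ cosh(T)/(2ω²)`. -/
theorem abs_deriv_QT_le (T : ℝ) {ω : ℝ} (hω : 0 < ω) :
    |deriv (QT T) ω| ≤ Real.cosh T / (2 * ω ^ 2) := by
  have ha := Real.cosh_pos T
  obtain ⟨c, hc, hc0⟩ : ∃ c, 2 * Real.cosh (2 * T) = c + 2 ∧ 0 ≤ c :=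
    ⟨2 * Real.cosh (2 * T) - 2, by ring, by linarith [Real.one_le_cosh (2 * T)]⟩
  have hpos : 0 < (4 * ω + 2) ^ 2 + c := by positivity
  have hlin : HasDerivAt (fun x : ℝ => 4 * x + 2) 4 ω := by
    simpa using ((hasDerivAt_id ω).const_mul 4).add_const 2
  have hd : HasDerivAt (QT T)
      (8 * Real.cosh T * (c - (4 * ω + 2) ^ 2) / ((4 * ω + 2) ^ 2 + c) ^ 2) ω := by
    have h := ((hlin.const_mul 2).mul_const (Real.cosh T)).div
      (((hlin.pow 2).sub_const 2).add_const (2 * Real.cosh (2 * T)))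
      (by rw [hc]; simp only [Pi.pow_apply]; linarith)
    refine h.congr_deriv ?_
    rw [hc]
    simp only [Pi.pow_apply]
    rw [show (4 * ω + 2) ^ 2 - 2 + (c + 2) = (4 * ω + 2) ^ 2 + c by ring]
    congr 1
    push_cast
    ring
  have hnum : |c - (4 * ω + 2) ^ 2| ≤ (4 * ω + 2) ^ 2 + c := by
    rw [abs_le]; constructor <;> nlinarith [sq_nonneg (4 * ω + 2)]
  rw [hd.deriv, abs_div, abs_mul, abs_of_pos (by positivity : 0 < 8 * Real.cosh T),
    abs_of_pos (by positivity : 0 < ((4 * ω + 2) ^ 2 + c) ^ 2)]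
  calc 8 * Real.cosh T * |c - (4 * ω + 2) ^ 2| / ((4 * ω + 2) ^ 2 + c) ^ 2
      ≤ 8 * Real.cosh T * ((4 * ω + 2) ^ 2 + c) / ((4 * ω + 2) ^ 2 + c) ^ 2 := by gcongr
    _ = 8 * Real.cosh T / ((4 * ω + 2) ^ 2 + c) := by field_simp
    _ ≤ 8 * Real.cosh T / (16 * ω ^ 2) := by
        gcongr
        nlinarith
    _ = Real.cosh T / (2 * ω ^ 2) := by field_simp; norm_num

/-- `ω ↦ 1/(ω √(ω - t))` is integrable on `(t, ∞)` with integral `π/√t`. -/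
theorem integrableOn_and_integral_inv_mul_sqrt_sub {t : ℝ} (ht : 0 < t) :
    IntegrableOn (fun ω : ℝ => 1 / (ω * √(ω - t))) (Set.Ioi t) ∧
      ∫ ω in Set.Ioi t, 1 / (ω * √(ω - t)) = Real.pi / √t := by
  have hst : 0 < √t := Real.sqrt_pos.2 ht
  set F : ℝ → ℝ := fun ω => 2 / √t * Real.arctan (√(ω - t) / √t) with hF
  have hcont : ContinuousWithinAt F (Set.Ici t) t :=
    (by fun_prop : Continuous F).continuousWithinAt
  have hderiv : ∀ ω ∈ Set.Ioi t, HasDerivAt F (1 / (ω * √(ω - t))) ω := by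
    intro ω hω
    have hω' : 0 < ω - t := sub_pos.2 hω
    have hω0 : 0 < ω := ht.trans hω
    have hs : 0 < √(ω - t) := Real.sqrt_pos.2 hω'
    have h := (((((hasDerivAt_id ω).sub_const t).sqrt hω'.ne').div_const √t).arctan).const_mul
      (2 / √t)
    refine h.congr_deriv ?_
    simp only [id]
    rw [div_pow, Real.sq_sqrt hω'.le, Real.sq_sqrt ht.le,
      show 1 + (ω - t) / t = ω / t by field_simp; ring]
    field_simp
    exact (Real.sq_sqrt ht.le).symm
  have hnn : ∀ ω ∈ Set.Ioi t, 0 ≤ 1 / (ω * √(ω - t)) := fun ω hω => by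
    have : 0 < ω := ht.trans hω
    positivity
  have hlim : Filter.Tendsto F Filter.atTop (nhds (2 / √t * (Real.pi / 2))) := by
    refine Filter.Tendsto.const_mul _ ?_
    refine (Real.tendsto_arctan_atTop.mono_right nhdsWithin_le_nhds).comp ?_
    refine Filter.Tendsto.atTop_div_const hst ?_
    exact Real.tendsto_sqrt_atTop.comp (Filter.tendsto_atTop_add_const_right _ (-t) Filter.tendsto_id)
  refine ⟨integrableOn_Ioi_deriv_of_nonneg hcont hderiv hnn hlim, ?_⟩
  rw [integral_Ioi_of_hasDerivAt_of_nonneg hcont hderiv hnn hlim]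
  simp only [hF, sub_self, Real.sqrt_zero, zero_div, Real.arctan_zero, mul_zero, sub_zero]
  ring

/-- The pointwise bound `|k_T(t)| ≤ cosh(T)/2 · t^{−3/2}` for `t > 0`. -/
theorem abs_kT_le (T : ℝ) {t : ℝ} (ht : 0 < t) :
    |kT T t| ≤ Real.cosh T / 2 * t ^ (-(3 / 2) : ℝ) := by
  have ha := Real.cosh_pos T
  have hst : 0 < √t := Real.sqrt_pos.2 ht
  obtain ⟨hint, hval⟩ := integrableOn_and_integral_inv_mul_sqrt_sub ht
  have hbound : ‖∫ ω in Set.Ioi t, deriv (QT T) ω / √(ω - t)‖ ≤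
      ∫ ω in Set.Ioi t, Real.cosh T / (2 * t) * (1 / (ω * √(ω - t))) := by
    refine norm_integral_le_of_norm_le (hint.const_mul _) ?_
    refine (ae_restrict_mem measurableSet_Ioi).mono fun ω hω => ?_
    have hω' : t < ω := hω
    have hω0 : 0 < ω := ht.trans hω'
    have hs : 0 < √(ω - t) := Real.sqrt_pos.2 (sub_pos.2 hω')
    rw [norm_div, Real.norm_eq_abs, Real.norm_eq_abs, abs_of_pos hs]
    calc |deriv (QT T) ω| / √(ω - t) ≤ Real.cosh T / (2 * ω ^ 2) / √(ω - t) := by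
          gcongr
          exact abs_deriv_QT_le T hω0
      _ ≤ Real.cosh T / (2 * (t * ω)) / √(ω - t) := by
          gcongr
          nlinarith
      _ = Real.cosh T / (2 * t) * (1 / (ω * √(ω - t))) := by field_simp
  rw [integral_const_mul, hval, Real.norm_eq_abs] at hbound
  have hpow : t ^ (-(3 / 2) : ℝ) = 1 / (t * √t) := by
    rw [Real.rpow_neg ht.le, show (3 / 2 : ℝ) = 1 + 1 / 2 by norm_num, Real.rpow_add ht,
      Real.rpow_one, ← Real.sqrt_eq_rpow, one_div]
  rw [kT, abs_mul, abs_neg, abs_of_pos (by positivity : 0 < 1 / Real.pi), hpow]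
  calc 1 / Real.pi * |∫ ω in Set.Ioi t, deriv (QT T) ω / √(ω - t)|
      ≤ 1 / Real.pi * (Real.cosh T / (2 * t) * (Real.pi / √t)) := by gcongr
    _ = Real.cosh T / 2 * (1 / (t * √t)) := by field_simp

/-- Rapid decay outside the ball of radius `4T`:
`∫_{sinh²(2T)}^∞ |k_T(t)| dt ≤ C e^{−T}` for `T ≥ 1`. -/
theorem stmt_14 :
    ∃ C : ℝ, 0 < C ∧ ∀ T : ℝ, 1 ≤ T →
      (∫ t in Set.Ioi (Real.sinh (2 * T) ^ 2), |kT T t|) ≤ C * Real.exp (-T) := by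
  refine ⟨2, two_pos, fun T hT => ?_⟩
  have hsT : 0 < Real.sinh T := Real.sinh_pos_iff.2 (by linarith)
  have hs2T : 0 < Real.sinh (2 * T) := Real.sinh_pos_iff.2 (by linarith)
  have ha := Real.cosh_pos T
  have hS : 0 < Real.sinh (2 * T) ^ 2 := by positivity
  have hsinh : Real.exp T / 4 ≤ Real.sinh T := by
    have hprod : Real.exp T * Real.exp (-T) = 1 := by rw [← Real.exp_add]; simp
    have hT1 := Real.add_one_le_exp T
    rw [Real.sinh_eq]
    nlinarith [Real.exp_pos (-T)]
  calc (∫ t in Set.Ioi (Real.sinh (2 * T) ^ 2), |kT T t|)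
      ≤ ∫ t in Set.Ioi (Real.sinh (2 * T) ^ 2), Real.cosh T / 2 * t ^ (-(3 / 2) : ℝ) := by
        refine integral_mono_of_nonneg (Filter.Eventually.of_forall fun t => abs_nonneg _)
          ((integrableOn_Ioi_rpow_of_lt (by norm_num) hS).const_mul _) ?_
        exact (ae_restrict_mem measurableSet_Ioi).mono fun t ht => abs_kT_le T (hS.trans ht)
    _ = Real.cosh T / Real.sinh (2 * T) := by
        rw [integral_const_mul, integral_Ioi_rpow_of_lt (by norm_num) hS,
          show (-(3 / 2) + 1 : ℝ) = -(1 / 2) by norm_num, Real.rpow_neg hS.le,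
          ← Real.sqrt_eq_rpow, Real.sqrt_sq hs2T.le]
        field_simp
    _ = 1 / (2 * Real.sinh T) := by
        rw [Real.sinh_two_mul]
        field_simp
    _ ≤ 1 / (2 * (Real.exp T / 4)) := by gcongr
    _ = 2 * Real.exp (-T) := by
        rw [Real.exp_neg]
        field_simp
        norm_num
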